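/- Let α be irrational and let β be a real number with β ∉ ℤα + ℤ (so e^{2πinα} ≠ e^{2πiβ} for all n ∈ ℤ) such that β ∉ CD₁^α, i.e., for all c>0 and τ≥0 there exists a nonzero integer N with ‖Nα−β‖ < c/|N|^{1+τ}. Then for every ε > 0 and every r ∈ ℕ there exists a C^∞ function φ : 𝕋¹ → ℂ with C^r norm ‖φ‖_r < ε such that no C^∞ function ψ : 𝕋¹ → ℂ satisfies the twisted cohomological equation ψ(θ+α) − e^{2πiβ}ψ(θ) = φ(θ) for all θ ∈ 𝕋¹. -/

import Mathlib

open MeasureTheory Metric Complex Real Set Function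

noncomputable section

/-- Distance from a real number to the nearest integer. -/
def distInt (x : ℝ) : ℝ := ⨅ p : ℤ, |x - (p : ℝ)|

/-- The Diophantine condition CD on a real number. -/
def IsCD (α : ℝ) : Prop :=
  Irrational α ∧ ∃ c : ℝ, 0 < c ∧ ∃ τ : ℝ, 0 ≤ τ ∧
    ∀ N : ℕ, 1 ≤ N → c / (N : ℝ) ^ (1 + τ) ≤ distInt (N * α)

/-- The Diophantine condition CD₁ on a pair of real numbers. -/
def IsCD1 (α β : ℝ) : Prop :=
  Irrational α ∧ ∃ c : ℝ, 0 < c ∧ ∃ τ : ℝ, 0 ≤ τ ∧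
    (∀ N : ℕ, 1 ≤ N → c / (N : ℝ) ^ (1 + τ) ≤ distInt (N * α)) ∧
    (∀ N : ℤ, N ≠ 0 → c / |(N : ℝ)| ^ (1 + τ) ≤ distInt (N * α - β))

/-- The C^r norm of a smooth Banach-space-valued function on the circle. -/
def cNorm {E : Type*} [NormedAddCommGroup E] [NormedSpace ℝ E] (r : ℕ) (g : ℝ → E) : ℝ :=
  ∑ i ∈ Finset.range (r + 1), ⨆ θ : ℝ, ‖iteratedDeriv i g θ‖

/-- C^∞ and ℤ-periodic : a smooth function on the circle 𝕋¹ = ℝ/ℤ. -/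
def SmoothPer {E : Type*} [NormedAddCommGroup E] [NormedSpace ℝ E] (g : ℝ → E) : Prop :=
  ContDiff ℝ (⊤ : ℕ∞) g ∧ Function.Periodic g 1

/-- Fourier coefficients of a function on the circle. -/
def fourierCoef (φ : ℝ → ℂ) (n : ℤ) : ℂ :=
  ∫ θ in (0:ℝ)..1, φ θ * Complex.exp (-(2 * π * I * n * θ))

/-- The closed disc of radius r in ℂ. -/
abbrev OmDom (r : ℝ) : Set ℂ := Metric.closedBall (0 : ℂ) r

instance (r : ℝ) : CompactSpace (OmDom r) :=
  isCompact_iff_compactSpace.mp (isCompact_closedBall (0:ℂ) r)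

/-- The Banach space Ω(closure D(0,r)) realized as continuous functions on the closed disc
(holomorphy on the open disc is the predicate `HolOm`), with the sup norm. -/
abbrev Om (r : ℝ) := C(OmDom r, ℂ)

-- Evaluation of an element of Ω at a point of the closed disc (junk value outside).
open scoped Classical in
def evOm {r : ℝ} (g : Om r) (z : ℂ) : ℂ :=
  if h : z ∈ OmDom r then g ⟨z, h⟩ else 0

/-- Holomorphy on the open disc. -/
def HolOm {r : ℝ} (g : Om r) : Prop :=
  DifferentiableOn ℂ (evOm g) (Metric.ball (0:ℂ) r)

/-- The model fiber map z ↦ e^{2πiβ} z as an element of Ω(closure 𝔻). -/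
def lamMap (β : ℝ) : Om 1 :=
  ⟨fun z => Complex.exp (2 * π * I * β) * z.val, by fun_prop⟩

/-- `u` is a C^∞ curve with values in the open unit disc, invariant under the fibered
holomorphic dynamics F(θ,z) = (θ+α, f(θ,z)). -/
def IsInvCurve (α : ℝ) (f : ℝ → Om 1) (u : ℝ → ℂ) : Prop :=
  ContDiff ℝ (⊤ : ℕ∞) u ∧ Function.Periodic u 1 ∧ (∀ θ, ‖u θ‖ < 1) ∧
    ∀ θ, evOm (f θ) (u θ) = u (θ + α)

/-- The curve `u` has degree zero (the derivative along the curve admits a continuous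
logarithm ℓ on 𝕋¹), is indifferent (∫ log|∂_z f(θ,u(θ))| dθ = 0), and its transversal
rotation number (1/2πi)∫ ℓ is β mod 1. -/
def HasRotNum (β : ℝ) (f : ℝ → Om 1) (u : ℝ → ℂ) : Prop :=
  ∃ ℓ : ℝ → ℂ, Continuous ℓ ∧ Function.Periodic ℓ 1 ∧
    (∀ θ, Complex.exp (ℓ θ) = deriv (evOm (f θ)) (u θ)) ∧
    (∫ θ in (0:ℝ)..1, (ℓ θ).re) = 0 ∧
    ∃ m : ℤ, (∫ θ in (0:ℝ)..1, ℓ θ) = 2 * π * I * (β + m)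

/-- Smallest singular value of an ℝ-linear map ℂ → ℂ (ℂ ≅ ℝ²). -/
def minSv (A : ℂ →L[ℝ] ℂ) : ℝ := ⨅ v : Metric.sphere (0:ℂ) 1, ‖A v.val‖

end

/-- The character `θ ↦ e^{2πinθ}` of the circle. -/
noncomputable def circleChar (n : ℤ) (θ : ℝ) : ℂ := Complex.exp (2 * π * I * n * θ)

/-- The small divisor `e^{2πinα} - e^{2πiβ}` of the twisted cohomological equation. -/
noncomputable def smallDivisor (α β : ℝ) (n : ℤ) : ℂ := circleChar n α - Complex.exp (2 * π * I * β)

lemma norm_circleChar (n : ℤ) (θ : ℝ) : ‖circleChar n θ‖ = 1 := by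
  rw [circleChar, ← Complex.norm_exp_ofReal_mul_I (2 * π * n * θ)]
  congr 2
  push_cast
  ring

lemma circleChar_periodic (n : ℤ) : Function.Periodic (circleChar n) 1 := by
  intro θ
  rw [circleChar, circleChar, Complex.exp_eq_exp_iff_exists_int]
  exact ⟨n, by push_cast; ring⟩

lemma circleChar_add (n : ℤ) (θ η : ℝ) :
    circleChar n (θ + η) = circleChar n θ * circleChar n η := by
  rw [circleChar, circleChar, circleChar, ← Complex.exp_add]
  congr 1
  push_cast
  ring

lemma contDiff_circleChar (n : ℤ) {N : WithTop ℕ∞} : ContDiff ℝ N (circleChar n) := by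
  unfold circleChar
  exact (contDiff_const.mul Complex.ofRealCLM.contDiff).cexp

lemma hasDerivAt_circleChar (n : ℤ) (θ : ℝ) :
    HasDerivAt (circleChar n) (2 * π * I * n * circleChar n θ) θ := by
  have h : HasDerivAt (fun t : ℝ => 2 * π * I * n * (t : ℂ)) (2 * π * I * n) θ := by
    simpa using (Complex.ofRealCLM.hasDerivAt (x := θ)).const_mul (2 * π * I * n)
  rw [mul_comm]
  exact h.cexp

lemma iteratedDeriv_mul_circleChar (c : ℂ) (n : ℤ) (i : ℕ) :
    iteratedDeriv i (fun θ => c * circleChar n θ) =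
      fun θ => c * (2 * π * I * n) ^ i * circleChar n θ := by
  induction i with
  | zero => simp
  | succ i ih =>
    rw [iteratedDeriv_succ, ih]
    funext θ
    rw [((hasDerivAt_circleChar n θ).const_mul _).deriv]
    ring

lemma norm_iteratedFDeriv_mul_circleChar (c : ℂ) (n : ℤ) (i : ℕ) (θ : ℝ) :
    ‖iteratedFDeriv ℝ i (fun θ => c * circleChar n θ) θ‖ = ‖c‖ * (2 * π * |(n : ℝ)|) ^ i := by
  rw [norm_iteratedFDeriv_eq_norm_iteratedDeriv, iteratedDeriv_mul_circleChar]
  simp [norm_circleChar, abs_of_pos Real.pi_pos]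

/-- A trigonometric series with rapidly decreasing coefficients is smooth on the circle. -/
lemma smoothPer_tsum_circleChar {c : ℕ → ℂ} {n : ℕ → ℤ}
    (h : ∀ i, Summable fun k => ‖c k‖ * (2 * π * |(n k : ℝ)|) ^ i) :
    SmoothPer fun θ => ∑' k, c k * circleChar (n k) θ := by
  refine ⟨contDiff_tsum (fun k => contDiff_const.mul (contDiff_circleChar _)) (fun i _ => h i)
    fun i k θ _ => (norm_iteratedFDeriv_mul_circleChar _ _ _ _).le, fun θ => ?_⟩
  simp only [circleChar_periodic _ θ]

lemma norm_iteratedDeriv_tsum_circleChar_le {c : ℕ → ℂ} {n : ℕ → ℤ}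
    (h : ∀ i, Summable fun k => ‖c k‖ * (2 * π * |(n k : ℝ)|) ^ i) (i : ℕ) (θ : ℝ) :
    ‖iteratedDeriv i (fun θ => ∑' k, c k * circleChar (n k) θ) θ‖ ≤
      ∑' k, ‖c k‖ * (2 * π * |(n k : ℝ)|) ^ i := by
  rw [← norm_iteratedFDeriv_eq_norm_iteratedDeriv,
    iteratedFDeriv_tsum_apply (N := (⊤ : ℕ∞)) (fun k => contDiff_const.mul (contDiff_circleChar _))
      (fun i _ => h i) (fun i k θ _ => (norm_iteratedFDeriv_mul_circleChar _ _ _ _).le) le_top]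
  exact tsum_of_norm_bounded (h i).hasSum fun k =>
    (norm_iteratedFDeriv_mul_circleChar _ _ _ _).le

lemma fourierCoef_eq (φ : ℝ → ℂ) (m : ℤ) :
    fourierCoef φ m = ∫ θ in (0 : ℝ)..1, φ θ * circleChar (-m) θ := by
  simp [fourierCoef, circleChar]

lemma fourierCoef_circleChar (n m : ℤ) :
    fourierCoef (circleChar n) m = if n = m then 1 else 0 := by
  have h (θ : ℝ) : circleChar n θ * circleChar (-m) θ =
      Complex.exp (2 * π * I * ((n - m : ℤ) : ℂ) * θ) := by
    rw [circleChar, circleChar, ← Complex.exp_add]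
    congr 1
    push_cast
    ring
  simp only [fourierCoef_eq, h]
  split_ifs with hnm
  · simp [hnm]
  · have hne : (2 * π * I * ((n - m : ℤ) : ℂ)) ≠ 0 :=
      mul_ne_zero Complex.two_pi_I_ne_zero (Int.cast_ne_zero.2 (sub_ne_zero.2 hnm))
    rw [integral_exp_mul_complex hne, div_eq_zero_iff, sub_eq_zero,
      Complex.exp_eq_exp_iff_exists_int]
    exact .inl ⟨n - m, by push_cast; ring⟩

/-- An absolutely convergent trigonometric series with distinct frequencies has the expected
Fourier coefficients. -/
lemma fourierCoef_tsum_circleChar {c : ℕ → ℂ} {n : ℕ → ℤ} (hc : Summable fun k => ‖c k‖)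
    (hn : Function.Injective n) (j : ℕ) :
    fourierCoef (fun θ => ∑' k, c k * circleChar (n k) θ) (n j) = c j := by
  have hcont (k : ℤ) : Continuous (circleChar k) := (contDiff_circleChar k (N := 0)).continuous
  have hsum : HasSum (fun k => ∫ θ in (0 : ℝ)..1, c k * circleChar (n k) θ * circleChar (-n j) θ)
      (∫ θ in (0 : ℝ)..1, (∑' k, c k * circleChar (n k) θ) * circleChar (-n j) θ) := by
    refine intervalIntegral.hasSum_integral_of_dominated_convergence (fun k _ => ‖c k‖)
      (fun k => ?_) (fun k => ?_) ?_ ?_ ?_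
    · exact ((continuous_const.mul (hcont _)).mul (hcont _)).aestronglyMeasurable
    · exact Filter.Eventually.of_forall fun θ _ => by simp [norm_circleChar]
    · exact Filter.Eventually.of_forall fun _ _ => hc
    · exact intervalIntegrable_const
    · refine Filter.Eventually.of_forall fun θ _ => HasSum.mul_right _ (Summable.hasSum ?_)
      refine Summable.of_norm ?_
      simpa [norm_circleChar] using hc
  rw [fourierCoef_eq, ← hsum.tsum_eq, tsum_eq_single j]
  · simp only [mul_assoc]
    rw [intervalIntegral.integral_const_mul, ← fourierCoef_eq, fourierCoef_circleChar]
    simp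
  · intro k hk
    simp only [mul_assoc]
    rw [intervalIntegral.integral_const_mul, ← fourierCoef_eq, fourierCoef_circleChar,
      if_neg (hn.ne hk), mul_zero]

lemma tendsto_fourierCoef_cofinite (ψ : ℝ → ℂ) :
    Filter.Tendsto (fourierCoef ψ) Filter.cofinite (nhds 0) := by
  have h := (Real.tendsto_integral_exp_smul_cocompact ((Set.Ioc 0 1).indicator ψ)).comp
    Int.isClosedEmbedding_coe_real.tendsto_cocompact
  rw [Filter.cocompact_eq_cofinite] at h
  refine h.congr fun m => ?_
  simp only [Function.comp_apply]
  rw [fourierCoef_eq, intervalIntegral.integral_of_le zero_le_one,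
    ← MeasureTheory.integral_indicator measurableSet_Ioc]
  congr 1
  funext θ
  by_cases hθ : θ ∈ Set.Ioc (0 : ℝ) 1
  · simp only [Set.indicator_of_mem hθ]
    rw [Circle.smul_def, Real.fourierChar_apply, smul_eq_mul, mul_comm, circleChar]
    congr 2
    push_cast
    ring
  · simp [Set.indicator_of_notMem hθ]

lemma fourierCoef_comp_add {ψ : ℝ → ℂ} (hψ : Function.Periodic ψ 1) (α : ℝ) (m : ℤ) :
    fourierCoef (fun θ => ψ (θ + α)) m = circleChar m α * fourierCoef ψ m := by
  have hinv : circleChar m α * circleChar (-m) α = 1 := by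
    rw [circleChar, circleChar, ← Complex.exp_add]
    simp
  have hshift (θ : ℝ) : ψ (θ + α) * circleChar (-m) θ =
      circleChar m α * (ψ (θ + α) * circleChar (-m) (θ + α)) := by
    rw [circleChar_add]
    linear_combination (-(ψ (θ + α) * circleChar (-m) θ)) * hinv
  have hper := (hψ.mul (circleChar_periodic (-m))).intervalIntegral_add_eq α 0
  simp only [fourierCoef_eq, hshift]
  rw [intervalIntegral.integral_const_mul,
    intervalIntegral.integral_comp_add_right (fun θ => ψ θ * circleChar (-m) θ)]
  simp only [Pi.mul_apply, zero_add] at hper ⊢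
  rw [add_comm 1 α, hper]

/-- The twisted cohomological equation on the level of Fourier coefficients. -/
lemma smallDivisor_mul_fourierCoef {α β : ℝ} {φ ψ : ℝ → ℂ} (hψ : SmoothPer ψ)
    (h : ∀ θ : ℝ, ψ (θ + α) - Complex.exp (2 * π * I * β) * ψ θ = φ θ) (m : ℤ) :
    smallDivisor α β m * fourierCoef ψ m = fourierCoef φ m := by
  have hc := hψ.1.continuous
  have hm : Continuous (circleChar (-m)) := (contDiff_circleChar (-m) (N := 0)).continuous
  rw [smallDivisor, sub_mul, ← fourierCoef_comp_add hψ.2]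
  simp only [fourierCoef_eq, ← h]
  rw [← intervalIntegral.integral_const_mul, ← intervalIntegral.integral_sub]
  · congr 1
    funext θ
    ring
  · exact (by fun_prop :
      Continuous fun θ => ψ (θ + α) * circleChar (-m) θ).intervalIntegrable _ _
  · exact (by fun_prop : Continuous fun θ =>
      Complex.exp (2 * π * I * β) * (ψ θ * circleChar (-m) θ)).intervalIntegrable _ _

lemma smallDivisor_ne_zero {α β : ℝ} (hres : ∀ n m : ℤ, β ≠ n * α + m) (n : ℤ) :
    smallDivisor α β n ≠ 0 := by
  intro h
  rw [smallDivisor, sub_eq_zero, circleChar, Complex.exp_eq_exp_iff_exists_int] at h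
  obtain ⟨m, hm⟩ := h
  apply hres n (-m)
  have h' : (2 * π * I) * ((n : ℂ) * α) = (2 * π * I) * (β + m) := by
    linear_combination hm
  have h'' : ((n * α : ℝ) : ℂ) = ((β + m : ℝ) : ℂ) := by
    push_cast
    exact mul_left_cancel₀ Complex.two_pi_I_ne_zero h'
  have := Complex.ofReal_injective h''
  push_cast
  linarith

lemma norm_smallDivisor_lt {α β y : ℝ} {n : ℤ} (h : distInt (n * α - β) < y) :
    ‖smallDivisor α β n‖ < 2 * π * y := by
  obtain ⟨p, hp⟩ := exists_lt_of_ciInf_lt h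
  have hfac : smallDivisor α β n = Complex.exp ((2 * π * β : ℝ) * I) *
      (Complex.exp (I * (2 * π * (n * α - β - p) : ℝ)) - 1) := by
    rw [mul_sub, mul_one, ← Complex.exp_add, smallDivisor, circleChar]
    congr 1
    · rw [Complex.exp_eq_exp_iff_exists_int]
      exact ⟨p, by push_cast; ring⟩
    · congr 1
      push_cast
      ring
  rw [hfac, norm_mul, Complex.norm_exp_ofReal_mul_I, one_mul]
  refine Real.norm_exp_I_mul_ofReal_sub_one_le.trans_lt ?_
  rw [Real.norm_eq_abs, abs_mul, abs_of_pos Real.two_pi_pos]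
  exact mul_lt_mul_of_pos_left hp Real.two_pi_pos

lemma exists_norm_smallDivisor_mul_pow_lt {α β : ℝ}
    (hβ : ∀ c : ℝ, 0 < c → ∀ τ : ℝ, 0 ≤ τ →
      ∃ N : ℤ, N ≠ 0 ∧ distInt (N * α - β) < c / |(N : ℝ)| ^ (1 + τ))
    {δ : ℝ} (hδ : 0 < δ) (m : ℕ) :
    ∃ N : ℤ, N ≠ 0 ∧ ‖smallDivisor α β N‖ * (2 * π * |(N : ℝ)|) ^ m < δ := by
  obtain ⟨N, hN, hlt⟩ := hβ (δ / (2 * π) ^ (m + 1)) (by positivity) m m.cast_nonneg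
  refine ⟨N, hN, ?_⟩
  have hN1 : 1 ≤ |(N : ℝ)| := by exact_mod_cast Int.one_le_abs hN
  have hN0 : 0 < |(N : ℝ)| := by linarith
  rw [show (1 + (m : ℝ)) = ((m + 1 : ℕ) : ℝ) by push_cast; ring, Real.rpow_natCast] at hlt
  calc ‖smallDivisor α β N‖ * (2 * π * |(N : ℝ)|) ^ m
      < 2 * π * (δ / (2 * π) ^ (m + 1) / |(N : ℝ)| ^ (m + 1)) * (2 * π * |(N : ℝ)|) ^ m :=
        mul_lt_mul_of_pos_right (norm_smallDivisor_lt hlt) (by positivity)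
    _ = δ / |(N : ℝ)| := by
        have := Real.pi_pos
        field_simp
        ring
    _ ≤ δ := div_le_self hδ.le hN1

lemma frequently_norm_smallDivisor_mul_pow_lt {α β : ℝ}
    (hβ : ∀ c : ℝ, 0 < c → ∀ τ : ℝ, 0 ≤ τ →
      ∃ N : ℤ, N ≠ 0 ∧ distInt (N * α - β) < c / |(N : ℝ)| ^ (1 + τ))
    (hres : ∀ n m : ℤ, β ≠ n * α + m)
    {δ : ℝ} (hδ : 0 < δ) (m : ℕ) :
    ∃ᶠ k : ℕ in Filter.atTop, ∃ N : ℤ, N.natAbs = k ∧ N ≠ 0 ∧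
      ‖smallDivisor α β N‖ * (2 * π * |(N : ℝ)|) ^ m < δ := by
  rw [Filter.frequently_atTop]
  intro M
  obtain ⟨δ', hδ', hδδ', hmin⟩ : ∃ δ' : ℝ, 0 < δ' ∧ δ' ≤ δ ∧
      ∀ N ∈ Finset.Icc (-(M : ℤ)) M, N ≠ 0 →
        δ' ≤ ‖smallDivisor α β N‖ * (2 * π * |(N : ℝ)|) ^ m := by
    generalize Finset.Icc (-(M : ℤ)) M = s
    induction s using Finset.induction_on with
    | empty => exact ⟨δ, hδ, le_rfl, by simp⟩
    | insert a s _ ih =>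
      obtain ⟨δ', h0, hle, h⟩ := ih
      by_cases ha : a = 0
      · refine ⟨δ', h0, hle, fun N hN hN0 => ?_⟩
        exact h N (Finset.mem_of_mem_insert_of_ne hN (ha ▸ hN0)) hN0
      · have hb := norm_pos_iff.2 (smallDivisor_ne_zero hres a)
        have ha' : 0 < |(a : ℝ)| := abs_pos.2 (Int.cast_ne_zero.2 ha)
        refine ⟨min δ' (‖smallDivisor α β a‖ * (2 * π * |(a : ℝ)|) ^ m),
          lt_min h0 (by positivity), (min_le_left _ _).trans hle, fun N hN hN0 => ?_⟩
        rcases Finset.mem_insert.1 hN with rfl | hN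
        · exact min_le_right _ _
        · exact (min_le_left _ _).trans (h N hN hN0)
  obtain ⟨N, hN, hlt⟩ := exists_norm_smallDivisor_mul_pow_lt hβ hδ' m
  refine ⟨N.natAbs, ?_, N, rfl, hN, hlt.trans_le hδδ'⟩
  by_contra hM
  exact (hmin N (Finset.mem_Icc.2 (by omega)) hN).not_gt hlt

/-- There are distinct frequencies along which the small divisors decay faster than any
power, with a prescribed bound on the first powers. -/
lemma exists_injective_smallDivisor_lt {α β : ℝ}
    (hβ : ∀ c : ℝ, 0 < c → ∀ τ : ℝ, 0 ≤ τ →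
      ∃ N : ℤ, N ≠ 0 ∧ distInt (N * α - β) < c / |(N : ℝ)| ^ (1 + τ))
    (hres : ∀ n m : ℤ, β ≠ n * α + m)
    {δ : ℝ} (hδ : 0 < δ) (r : ℕ) :
    ∃ n : ℕ → ℤ, Function.Injective n ∧ ∀ k i, i ≤ k + r →
      ‖smallDivisor α β (n k)‖ * (2 * π * |(n k : ℝ)|) ^ i ≤ δ * (1 / 2) ^ k := by
  obtain ⟨a, ha, h⟩ := Filter.extraction_forall_of_frequently fun k =>
    frequently_norm_smallDivisor_mul_pow_lt hβ hres (δ := δ * (1 / 2) ^ k) (by positivity) (k + r)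
  choose n hna hn0 hlt using h
  refine ⟨n, fun k l hkl => ha.injective (by rw [← hna, ← hna, hkl]), fun k i hi => ?_⟩
  refine le_trans ?_ (hlt k).le
  have h1 : 1 ≤ |(n k : ℝ)| := by exact_mod_cast Int.one_le_abs (hn0 k)
  have h2 : 1 ≤ 2 * π * |(n k : ℝ)| := by nlinarith [Real.pi_gt_three]
  gcongr

/-- if β is not in CD₁^α (and e^{2πinα} ≠ e^{2πiβ} for all n), one can find
arbitrarily small smooth φ for which the twisted cohomological equation has no C^∞ solution. -/
theorem twisted_cohomological_equation_counterexample
    (α β : ℝ) (hirr : Irrational α)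
    (hres : ∀ n m : ℤ, β ≠ n * α + m)
    (hβ : ∀ c : ℝ, 0 < c → ∀ τ : ℝ, 0 ≤ τ →
      ∃ N : ℤ, N ≠ 0 ∧ distInt (N * α - β) < c / |(N : ℝ)| ^ (1 + τ)) :
    ∀ ε : ℝ, 0 < ε → ∀ r : ℕ,
      ∃ φ : ℝ → ℂ, SmoothPer φ ∧ cNorm r φ < ε ∧
        ¬ ∃ ψ : ℝ → ℂ, SmoothPer ψ ∧
            ∀ θ : ℝ, ψ (θ + α) - Complex.exp (2 * π * I * β) * ψ θ = φ θ := by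
  intro ε hε r
  set δ : ℝ := ε / (4 * (r + 1)) with hδ_def
  have hδ : 0 < δ := by positivity
  obtain ⟨n, hn, hbound⟩ := exists_injective_smallDivisor_lt hβ hres hδ r
  have hgeom : HasSum (fun k : ℕ => δ * (1 / 2 : ℝ) ^ k) (δ * 2) := hasSum_geometric_two.mul_left δ
  have hsum (i : ℕ) : Summable fun k =>
      ‖smallDivisor α β (n k)‖ * (2 * π * |(n k : ℝ)|) ^ i := by
    refine hgeom.summable.of_norm_bounded_eventually_nat ?_
    filter_upwards [Filter.eventually_ge_atTop i] with k hk
    rw [Real.norm_of_nonneg (by positivity)]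
    exact hbound k i (by omega)
  refine ⟨fun θ => ∑' k, smallDivisor α β (n k) * circleChar (n k) θ,
    smoothPer_tsum_circleChar hsum, ?_, ?_⟩
  · have hle (i : ℕ) (hi : i ∈ Finset.range (r + 1)) :
        (⨆ θ : ℝ, ‖iteratedDeriv i
          (fun θ => ∑' k, smallDivisor α β (n k) * circleChar (n k) θ) θ‖) ≤ δ * 2 := by
      refine ciSup_le fun θ => (norm_iteratedDeriv_tsum_circleChar_le hsum i θ).trans ?_
      rw [← hgeom.tsum_eq]
      refine (hsum i).tsum_le_tsum (fun k => hbound k i ?_) hgeom.summable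
      have := Finset.mem_range.1 hi
      omega
    refine (Finset.sum_le_card_nsmul _ _ _ hle).trans_lt ?_
    have : ((r : ℝ) + 1) * (δ * 2) = ε / 2 := by
      rw [hδ_def]
      field_simp
      norm_num
    simp only [Finset.card_range, nsmul_eq_mul, Nat.cast_add, Nat.cast_one, this]
    linarith
  · rintro ⟨ψ, hψ, heq⟩
    have hone (k : ℕ) : fourierCoef ψ (n k) = 1 := by
      refine mul_left_cancel₀ (smallDivisor_ne_zero hres (n k)) ?_
      rw [smallDivisor_mul_fourierCoef hψ heq,
        fourierCoef_tsum_circleChar (by simpa using hsum 0) hn, mul_one]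
    have hlim := (tendsto_fourierCoef_cofinite ψ).comp hn.tendsto_cofinite
    refine one_ne_zero (tendsto_nhds_unique (hlim.congr fun k => hone k) ?_).symm
    exact tendsto_const_nhds
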